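/- arXiv:2112.01592 — 9 statements merged into one kernel-verified Lean document; each statement's English description precedes it below -/
import Mathlib

section
/- Let 0 < m ≤ M, let r > 0, let p ∈ [m, M] be a prediction, and let σ be a nonempty finite sequence of prices in [m, M] with best price p* = max σ. Suppose the prediction error is negative with value η, i.e. p* = p·(1−η) for some η ∈ [0, (M−m)/M]. Then the reservation algorithm ORA_r with reservation price r·p satisfies: if η ≤ 1−r then p* / RP(r·p, σ) ≤ (1−η)/r, and if η > 1−r then p* / RP(r·p, σ) ≤ (1−η)·M/m. (Theorem 2, negative-error case.) -/
/-- Profit of the reservation algorithm with reservation price `q` on a price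
sequence: the first price that is at least `q`, or the last price if none. -/
noncomputable def RP (q : ℝ) : List ℝ → ℝ
  | [] => 0
  | [x] => x
  | x :: xs => if q ≤ x then x else RP q xs

theorem RP_mem (q : ℝ) {σ : List ℝ} (hσ : σ ≠ []) : RP q σ ∈ σ := by
  fun_induction RP q σ <;> simp_all

theorem le_RP_of_mem {q a : ℝ} {σ : List ℝ} (ha : a ∈ σ) (hq : q ≤ a) : q ≤ RP q σ := by
  fun_induction RP q σ with
  | case1 => simp at ha
  | case2 x => simp_all
  | case3 x xs _ h => exact h
  | case4 x xs _ h ih =>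
    rcases List.mem_cons.mp ha with rfl | hxs
    · exact absurd hq h
    · exact ih hxs

theorem stmt0 (m M r p η pstar : ℝ) (σ : List ℝ)
    (hm : 0 < m) (hmM : m ≤ M) (hr : 0 < r)
    (hp : p ∈ Set.Icc m M)
    (hσ : ∀ x ∈ σ, x ∈ Set.Icc m M)
    (hmem : pstar ∈ σ) (hmax : ∀ x ∈ σ, x ≤ pstar)
    (hη : η ∈ Set.Icc 0 ((M - m) / M))
    (herr : pstar = p * (1 - η)) :
    (η ≤ 1 - r → pstar / RP (r * p) σ ≤ (1 - η) / r) ∧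
    (1 - r < η → pstar / RP (r * p) σ ≤ (1 - η) * M / m) := by
  have hp0 : 0 < p := hm.trans_le hp.1
  have hs0 : 0 < pstar := hm.trans_le (hσ _ hmem).1
  have hη0 : 0 < 1 - η := by
    rw [herr] at hs0
    exact pos_of_mul_pos_right hs0 hp0.le
  constructor
  · intro h
    have hle : r * p ≤ RP (r * p) σ := by
      refine le_RP_of_mem hmem ?_
      rw [herr, mul_comm r]
      gcongr
      linarith
    calc pstar / RP (r * p) σ ≤ pstar / (r * p) := by gcongr
      _ = (1 - η) / r := by rw [herr]; field_simp
  · intro _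
    have hle : m ≤ RP (r * p) σ := (hσ _ (RP_mem _ (List.ne_nil_of_mem hmem))).1
    calc pstar / RP (r * p) σ ≤ pstar / m := by gcongr
      _ ≤ (1 - η) * M / m := by
        rw [herr, mul_comm p]
        gcongr
        exact hp.2
end

section
/- Let 0 < m ≤ M, let r > 0, let p ∈ [m, M] be a prediction, and let σ be a nonempty finite sequence of prices in [m, M] with best price p* = max σ. Suppose the prediction error is positive with value η, i.e. p* = p·(1+η) for some η ∈ (0, (M−m)/m]. Then the reservation algorithm ORA_r with reservation price r·p satisfies: if η ≥ r−1 then p* / RP(r·p, σ) ≤ (1+η)/r, and if η < r−1 then p* / RP(r·p, σ) ≤ M/m. (Theorem 2, positive-error case.) -/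
theorem le_RP_of_mem_s1 {q y : ℝ} {σ : List ℝ} (hy : y ∈ σ) (hqy : q ≤ y) : q ≤ RP q σ := by
  induction σ using RP.induct q <;> grind [RP]

theorem stmt1 (m M r p η pstar : ℝ) (σ : List ℝ)
    (hm : 0 < m) (hmM : m ≤ M) (hr : 0 < r)
    (hp : p ∈ Set.Icc m M)
    (hσ : ∀ x ∈ σ, x ∈ Set.Icc m M)
    (hmem : pstar ∈ σ) (hmax : ∀ x ∈ σ, x ≤ pstar)
    (hη : η ∈ Set.Ioc 0 ((M - m) / m))
    (herr : pstar = p * (1 + η)) :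
    (r - 1 ≤ η → pstar / RP (r * p) σ ≤ (1 + η) / r) ∧
    (η < r - 1 → pstar / RP (r * p) σ ≤ M / m) := by
  have hpos : 0 < p := hm.trans_le hp.1
  have hRP := hσ _ (RP_mem (r * p) (List.ne_nil_of_mem hmem))
  refine ⟨fun h => ?_, fun _ => div_le_div₀ (hm.le.trans hmM) (hσ _ hmem).2 hm hRP.1⟩
  have hle : r * p ≤ RP (r * p) σ := le_RP_of_mem_s1 hmem (by rw [herr]; nlinarith)
  calc pstar / RP (r * p) σ ≤ pstar / (r * p) :=
        div_le_div_of_nonneg_left (hm.le.trans (hσ _ hmem).1) (by positivity) hle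
    _ = (1 + η) / r := by rw [herr]; field_simp
end

section
/- Let 0 < m ≤ M and let A be a deterministic online algorithm (its behavior when given prediction p = M). (i) Suppose s ∈ [m, M] satisfies A((s)) = true and A((q)) = false for every q ∈ [m, s), and set r = s/M. Then for every η ∈ [0, (M−m)/M] there exists a nonempty finite sequence σ of prices in [m, M] with max σ = (1−η)·M such that: if η ≤ 1−r then (max σ)/A(σ) ≥ (1−η)/r, and if η > 1−r then (max σ)/A(σ) ≥ (1−η)·M/m. (ii) If instead A((q)) = false for every q ∈ [m, M], then for every η ∈ [0, (M−m)/M] there exists such a σ with max σ = (1−η)·M and (max σ)/A(σ) ≥ (1−η)·M/m. (Theorem 1, negative-error case.) -/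
/-- Auxiliary: profit of a deterministic online algorithm `A` given the history
`pre` of already-rejected prices and the remaining price sequence. -/
def profitAux (A : List ℝ → Bool) : List ℝ → List ℝ → ℝ
  | _, [] => 0
  | _, [x] => x
  | pre, x :: xs => if A (pre ++ [x]) then x else profitAux A (pre ++ [x]) xs

/-- Profit of a deterministic online algorithm `A` on input `σ`: the price `σ_i`
for the least `i` with `A (σ_1, …, σ_i) = true`, or the last price otherwise. -/
def profit (A : List ℝ → Bool) (σ : List ℝ) : ℝ := profitAux A [] σ

theorem profit_pair_of_accept {A : List ℝ → Bool} {x y : ℝ} (h : A [x] = true) :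
    profit A [x, y] = x := by
  simp [profit, profitAux, h]

theorem profit_pair_of_reject {A : List ℝ → Bool} {x y : ℝ} (h : A [x] = false) :
    profit A [x, y] = y := by
  simp [profit, profitAux, h]

/-- A scaled best price `(1 - η) * M` with admissible error `η` lies in `[m, M]`. -/
theorem one_sub_mul_mem_Icc {m M η : ℝ} (hM : 0 < M) (hη : η ∈ Set.Icc 0 ((M - m) / M)) :
    (1 - η) * M ∈ Set.Icc m M := by
  have h := (le_div_iff₀ hM).1 hη.2
  have h₀ := mul_nonneg hη.1 hM.le
  constructor <;> linarith

theorem stmt2 (m M : ℝ) (hm : 0 < m) (hmM : m ≤ M) (A : List ℝ → Bool) :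
    (∀ s ∈ Set.Icc m M, A [s] = true → (∀ q ∈ Set.Ico m s, A [q] = false) →
      ∀ η ∈ Set.Icc 0 ((M - m) / M),
        ∃ σ : List ℝ, σ ≠ [] ∧ (∀ x ∈ σ, x ∈ Set.Icc m M) ∧
          ((1 - η) * M ∈ σ) ∧ (∀ x ∈ σ, x ≤ (1 - η) * M) ∧
          (η ≤ 1 - s / M → (1 - η) * M / profit A σ ≥ (1 - η) / (s / M)) ∧
          (1 - s / M < η → (1 - η) * M / profit A σ ≥ (1 - η) * M / m)) ∧
    ((∀ q ∈ Set.Icc m M, A [q] = false) →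
      ∀ η ∈ Set.Icc 0 ((M - m) / M),
        ∃ σ : List ℝ, σ ≠ [] ∧ (∀ x ∈ σ, x ∈ Set.Icc m M) ∧
          ((1 - η) * M ∈ σ) ∧ (∀ x ∈ σ, x ≤ (1 - η) * M) ∧
          (1 - η) * M / profit A σ ≥ (1 - η) * M / m) := by
  have hM : 0 < M := hm.trans_le hmM
  refine ⟨fun s hs hAs hAq η hη => ?_, fun hA η hη => ?_⟩
  · have hx := one_sub_mul_mem_Icc hM hη
    have hs₀ : 0 < s := hm.trans_le hs.1
    have hiff : η ≤ 1 - s / M ↔ s ≤ (1 - η) * M := by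
      rw [← div_le_iff₀ hM]
      exact le_sub_comm
    by_cases hle : η ≤ 1 - s / M
    · refine ⟨[s, (1 - η) * M], by simp, by simpa using ⟨hs, hx⟩, by simp,
        by simpa using hiff.1 hle, fun _ => ?_, fun h => absurd hle h.not_ge⟩
      rw [profit_pair_of_accept hAs, div_div_eq_mul_div]
    · have hlt : (1 - η) * M < s := not_le.1 (mt hiff.2 hle)
      refine ⟨[(1 - η) * M, m], by simp, by simpa using ⟨hx, hmM⟩, by simp,
        by simpa using hx.1, fun h => absurd h hle, fun _ => ?_⟩
      rw [profit_pair_of_reject (hAq _ ⟨hx.1, hlt⟩)]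
  · have hx := one_sub_mul_mem_Icc hM hη
    refine ⟨[(1 - η) * M, m], by simp, by simpa using ⟨hx, hmM⟩, by simp,
      by simpa using hx.1, ?_⟩
    rw [profit_pair_of_reject (hA _ hx)]
end

section
/- Let 0 < m ≤ M, let η ∈ (0, (M−m)/m], set p = M/(1+η), and let A be a deterministic online algorithm (its behavior when given prediction p). (i) Suppose s ∈ [m, M] satisfies A((s)) = true and A((q)) = false for every q ∈ [m, s), and set r = s/p. Then there exists a nonempty finite sequence σ of prices in [m, M] with max σ = M = p(1+η) such that (max σ)/A(σ) ≥ (1+η)/r. (ii) If instead A((q)) = false for every q ∈ [m, M], then there exists such a σ with max σ = M = p(1+η) and (max σ)/A(σ) ≥ M/m. (Theorem 1, positive-error case.) -/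
theorem stmt3 (m M η p : ℝ) (hm : 0 < m) (hmM : m ≤ M)
    (hη : η ∈ Set.Ioc 0 ((M - m) / m)) (hp : p = M / (1 + η))
    (A : List ℝ → Bool) :
    (∀ s ∈ Set.Icc m M, A [s] = true → (∀ q ∈ Set.Ico m s, A [q] = false) →
      ∃ σ : List ℝ, σ ≠ [] ∧ (∀ x ∈ σ, x ∈ Set.Icc m M) ∧
        (M ∈ σ) ∧ (∀ x ∈ σ, x ≤ M) ∧ M = p * (1 + η) ∧
        M / profit A σ ≥ (1 + η) / (s / p)) ∧
    ((∀ q ∈ Set.Icc m M, A [q] = false) →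
      ∃ σ : List ℝ, σ ≠ [] ∧ (∀ x ∈ σ, x ∈ Set.Icc m M) ∧
        (M ∈ σ) ∧ (∀ x ∈ σ, x ≤ M) ∧ M = p * (1 + η) ∧
        M / profit A σ ≥ M / m) := by
  have hη1 : 0 < 1 + η := by linarith [hη.1]
  have hpM : M = p * (1 + η) := by rw [hp, div_mul_cancel₀ _ hη1.ne']
  refine ⟨fun s hs hAs _ => ⟨[s, M], by simp, ?_, by simp, ?_, hpM, ?_⟩,
    fun hA => ⟨[M, m], by simp, ?_, by simp, ?_, hpM, ?_⟩⟩
  · simp [hs.1, hs.2, hmM]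
  · simp [hs.2]
  · have hprofit : profit A [s, M] = s := by simp [profit, profitAux, hAs]
    rw [hprofit, ge_iff_le, div_div_eq_mul_div, mul_comm, ← hpM]
  · simp [hmM]
  · simp [hmM]
  · have hprofit : profit A [M, m] = m := by
      simp [profit, profitAux, hA M ⟨hmM, le_rfl⟩]
    rw [hprofit]
end

section
/- Let 0 < m ≤ M and let (A_p)_{p∈[m,M]} be any family of deterministic online algorithms indexed by a best-price prediction p (an oblivious algorithm with best-price prediction). Then there exist a prediction p ∈ [m, M] and a nonempty finite sequence σ of prices in [m, M], whose best price max σ equals p(1−η) for some η ∈ [0, (M−m)/M] or p(1+η) for some η ∈ (0, (M−m)/m], such that (max σ)/A_p(σ) ≥ √(M/m). In other words, no oblivious algorithm with best-price prediction achieves a worst-case ratio strictly below √(M/m) over all error values. (Corollary 1.) -/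
theorem profit_pair (A : List ℝ → Bool) (x y : ℝ) :
    profit A [x, y] = if A [x] then x else y := by
  simp [profit, profitAux]

theorem stmt4 (m M : ℝ) (hm : 0 < m) (hmM : m ≤ M)
    (A : ℝ → List ℝ → Bool) :
    ∃ p ∈ Set.Icc m M, ∃ σ : List ℝ, ∃ pstar : ℝ,
      (∀ x ∈ σ, x ∈ Set.Icc m M) ∧ pstar ∈ σ ∧ (∀ x ∈ σ, x ≤ pstar) ∧
      ((∃ η ∈ Set.Icc 0 ((M - m) / M), pstar = p * (1 - η)) ∨
       (∃ η ∈ Set.Ioc 0 ((M - m) / m), pstar = p * (1 + η))) ∧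
      pstar / profit (A p) σ ≥ Real.sqrt (M / m) := by
  have hM : 0 < M := hm.trans_le hmM
  obtain ⟨s, hs, hsq⟩ : ∃ s : ℝ, 0 < s ∧ s * s = m * M :=
    ⟨√(m * M), Real.sqrt_pos.2 (mul_pos hm hM), Real.mul_self_sqrt (mul_pos hm hM).le⟩
  have hms : m ≤ s := by nlinarith
  have hsM : s ≤ M := by nlinarith
  have hratio : √(M / m) = s / m := by
    rw [Real.sqrt_eq_iff_mul_self_eq (by positivity) (by positivity)]
    field_simp
    nlinarith
  refine ⟨M, ⟨hmM, le_rfl⟩, ?_⟩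
  by_cases hA : A M [s] = true
  · refine ⟨[s, M], M, by simp [*], by simp, by simp [hsM], Or.inl ⟨0, ?_, by simp⟩, ?_⟩
    · exact ⟨le_rfl, div_nonneg (sub_nonneg.2 hmM) hM.le⟩
    · rw [profit_pair, if_pos hA, hratio, ge_iff_le, div_le_div_iff₀ hm hs]
      nlinarith
  · refine ⟨[s, m], s, by simp [*], by simp, by simp [hms],
      Or.inl ⟨(M - s) / M, ⟨div_nonneg (sub_nonneg.2 hsM) hM.le, by gcongr⟩, ?_⟩, ?_⟩
    · field_simp
      ring
    · rw [profit_pair, if_neg hA, hratio]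
end

section
/- Let 0 < m ≤ M and 0 ≤ H_n ≤ (M−m)/M. Let (A_p)_{p∈[m,M]} be a family of deterministic online algorithms that is robust, i.e. for every p ∈ [m, M] and every nonempty finite sequence σ of prices in [m, M] whose best price max σ equals p(1−η) for some η ∈ [0, (M−m)/M] or p(1+η) for some η ∈ (0, (M−m)/m], one has (max σ)/A_p(σ) ≤ √(M/m). Then for every η ∈ [0, H_n] and every ε > 0 there exist p ∈ [m, M] and a nonempty finite sequence σ of prices in [m, M] with max σ = p(1−η) such that (max σ)/A_p(σ) > min{(1−η)/(1−H_n), √(M/m)} − ε. (Theorem 4, negative-error case: the worst-case ratio of any robust non-oblivious algorithm at negative error η is at least min{(1−η)/(1−H_n), √(M/m)}.) -/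
theorem profit_singleton (A : List ℝ → Bool) (x : ℝ) : profit A [x] = x := by
  simp [profit, profitAux]

/-- The largest admissible price `M` is always a possible best price, either with negative
error (when the prediction is `M`) or with positive error. -/
theorem top_price_admissible {m M p : ℝ} (hm : 0 < m) (hmM : m ≤ M) (hp : p ∈ Set.Icc m M) :
    (∃ η ∈ Set.Icc 0 ((M - m) / M), M = p * (1 - η)) ∨
      (∃ η ∈ Set.Ioc 0 ((M - m) / m), M = p * (1 + η)) := by
  have hp0 : 0 < p := hm.trans_le hp.1
  have hM : 0 < M := hm.trans_le hmM
  rcases hp.2.eq_or_lt with h | h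
  · exact Or.inl ⟨0, ⟨le_rfl, div_nonneg (by linarith) hM.le⟩, by rw [h]; ring⟩
  · refine Or.inr ⟨(M - p) / p, ⟨div_pos (by linarith) hp0, ?_⟩, by field_simp; ring⟩
    exact div_le_div₀ (by linarith) (by linarith [hp.1]) hm hp.1

theorem stmt8 (m M Hn : ℝ) (hm : 0 < m) (hmM : m ≤ M)
    (hHn0 : 0 ≤ Hn) (hHn : Hn ≤ (M - m) / M)
    (A : ℝ → List ℝ → Bool)
    (hrobust : ∀ p ∈ Set.Icc m M, ∀ σ : List ℝ, ∀ pstar : ℝ,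
      (∀ x ∈ σ, x ∈ Set.Icc m M) → pstar ∈ σ → (∀ x ∈ σ, x ≤ pstar) →
      ((∃ η ∈ Set.Icc 0 ((M - m) / M), pstar = p * (1 - η)) ∨
       (∃ η ∈ Set.Ioc 0 ((M - m) / m), pstar = p * (1 + η))) →
      pstar / profit (A p) σ ≤ Real.sqrt (M / m)) :
    ∀ η ∈ Set.Icc 0 Hn, ∀ ε > (0 : ℝ), ∃ p ∈ Set.Icc m M, ∃ σ : List ℝ,
      σ ≠ [] ∧ (∀ x ∈ σ, x ∈ Set.Icc m M) ∧
      (p * (1 - η) ∈ σ) ∧ (∀ x ∈ σ, x ≤ p * (1 - η)) ∧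
      p * (1 - η) / profit (A p) σ > min ((1 - η) / (1 - Hn)) (Real.sqrt (M / m)) - ε := by
  intro η hη ε hε
  have hM : 0 < M := hm.trans_le hmM
  have hHnM : m ≤ M * (1 - Hn) := by
    rw [le_div_iff₀ hM] at hHn
    linarith
  have hHn1 : 0 < 1 - Hn := pos_of_mul_pos_right (hm.trans_le hHnM) hM.le
  have hη1 : 0 < 1 - η := by linarith [hη.2]
  have hηM : m ≤ M * (1 - η) :=
    hHnM.trans (mul_le_mul_of_nonneg_left (by linarith [hη.2]) hM.le)
  set r := Real.sqrt (M / m) with hr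
  have hr1 : 1 ≤ r := Real.one_le_sqrt.mpr ((one_le_div hm).mpr hmM)
  have hrr : m * r * r = M := by
    rw [mul_assoc, hr, Real.mul_self_sqrt (div_nonneg hM.le hm.le)]
    field_simp
  obtain ⟨P, hPm, hPη, hPr, hratio⟩ : ∃ P, m ≤ P ∧ P ≤ M * (1 - η) ∧ (P < m * r ∨ r = 1) ∧
      min ((1 - η) / (1 - Hn)) r - ε < P / m := by
    by_cases h : M * (1 - η) < m * r
    · refine ⟨M * (1 - η), hηM, le_rfl, Or.inl h, ?_⟩
      have h1 : (1 - η) / (1 - Hn) ≤ M * (1 - η) / m := by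
        rw [div_le_div_iff₀ hHn1 hm]
        nlinarith
      linarith [min_le_left ((1 - η) / (1 - Hn)) r]
    · refine ⟨max m (m * r - m * (ε / 2)), le_max_left _ _, ?_, ?_, ?_⟩
      · exact max_le hηM (by nlinarith [mul_pos hm hε])
      · rcases hr1.eq_or_lt with h1 | h1
        · exact Or.inr h1.symm
        · exact Or.inl (max_lt (by nlinarith) (by nlinarith [mul_pos hm hε]))
      · rw [lt_div_iff₀ hm]
        nlinarith [min_le_right ((1 - η) / (1 - Hn)) r, mul_pos hm hε,
          le_max_right m (m * r - m * (ε / 2))]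
  have hP0 : 0 < P := hm.trans_le hPm
  have hPM : P ≤ M := hPη.trans (by nlinarith [hη.1])
  have hp : P / (1 - η) ∈ Set.Icc m M :=
    ⟨hPm.trans (le_div_self hP0.le hη1 (by linarith [hη.1])), (div_le_iff₀ hη1).mpr hPη⟩
  have hpP : P / (1 - η) * (1 - η) = P := div_mul_cancel₀ P hη1.ne'
  refine ⟨P / (1 - η), hp, ?_⟩
  rw [hpP]
  rcases hPr with hPr | hr_one
  · have hreject : A (P / (1 - η)) [P] = false := by
      by_contra hacc
      have h := hrobust _ hp [P, M] M (by simp [hPm, hPM, hmM]) (by simp) (by simp [hPM])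
        (top_price_admissible hm hmM hp)
      rw [profit_pair, if_pos (by simpa using hacc), div_le_iff₀ hP0] at h
      nlinarith
    refine ⟨[P, m], by simp, by simp [hPm, hPM, hmM], by simp, by simp [hPm], ?_⟩
    rw [profit_pair, hreject]
    simpa using hratio
  · refine ⟨[P], by simp, by simp [hPm, hPM], by simp, by simp, ?_⟩
    rw [profit_singleton, div_self hP0.ne']
    linarith [min_le_right ((1 - η) / (1 - Hn)) r]
end

section
/- Let P ∈ {0,1}^n be a response string in which at most H responses are wrong. (a) If P_i = 1 and the number of indices j > i with P_j = 0 is at least H+1, then response i is wrong, i.e. p* ≥ a_i. (b) If P_i = 0 and the number of indices j < i with P_j = 1 is at least H+1, then response i is wrong, i.e. p* < a_i. (Correctness of the preprocessing phase of algorithm RLIS.) -/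
/-- The grid point `a_i = m · (M/m)^{i/n}`. -/
noncomputable def aVal (m M : ℝ) (n i : ℕ) : ℝ := m * (M / m) ^ ((i : ℝ) / (n : ℝ))

/-- The correct response to query `Q_i` ("is `p* ∈ E_i = [m, a_i)`?"):
`true` (i.e. 1) iff `p* < a_i`. -/
noncomputable def correctResp (m M : ℝ) (n : ℕ) (pstar : ℝ) (i : ℕ) : Bool :=
  decide (pstar < aVal m M n i)

/-- The grid is monotone in its index. -/
theorem aVal_le_aVal {m M : ℝ} (hm : 0 < m) (hmM : m ≤ M) (n : ℕ) {i j : ℕ} (hij : i ≤ j) :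
    aVal m M n i ≤ aVal m M n j := by
  have h : 1 ≤ M / m := (one_le_div hm).mpr hmM
  unfold aVal
  gcongr

theorem stmt10 (m M : ℝ) (n H : ℕ) (pstar : ℝ)
    (hm : 0 < m) (hmM : m ≤ M) (hn : 1 ≤ n)
    (hps : pstar ∈ Set.Icc m M)
    (P : ℕ → Bool)
    (hwrong : ((Finset.Icc 1 n).filter
        (fun i => P i ≠ correctResp m M n pstar i)).card ≤ H) :
    (∀ i ∈ Finset.Icc 1 n, P i = true →
        H + 1 ≤ ((Finset.Ioc i n).filter (fun j => P j = false)).card →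
        aVal m M n i ≤ pstar) ∧
    (∀ i ∈ Finset.Icc 1 n, P i = false →
        H + 1 ≤ ((Finset.Ico 1 i).filter (fun j => P j = true)).card →
        pstar < aVal m M n i) := by
  have hle {i j : ℕ} (hij : i ≤ j) := aVal_le_aVal hm hmM n hij
  constructor
  · intro i hi _ hcard
    by_contra! hlt
    refine absurd (hcard.trans ((Finset.card_le_card ?_).trans hwrong)) (by omega)
    intro j hj
    simp only [Finset.mem_filter, Finset.mem_Ioc, Finset.mem_Icc] at hi hj ⊢
    refine ⟨by omega, ?_⟩
    have hj_lt : pstar < aVal m M n j := hlt.trans_le (hle hj.1.1.le)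
    simp [correctResp, hj.2, hj_lt]
  · intro i hi _ hcard
    by_contra! hge
    refine absurd (hcard.trans ((Finset.card_le_card ?_).trans hwrong)) (by omega)
    intro j hj
    simp only [Finset.mem_filter, Finset.mem_Ico, Finset.mem_Icc] at hi hj ⊢
    refine ⟨by omega, ?_⟩
    have hj_le : aVal m M n j ≤ pstar := (hle hj.1.2.le).trans hge
    simp [correctResp, hj.2, hj_le]
end

section
/- Let P ∈ {0,1}^n be a response string in which at most H responses are wrong, suppose P contains at least one 1, let i₁ be the least index with P_{i₁} = 1, and let α be the number of indices j > i₁ with P_j = 0. Assume α ≤ H. Then p* ≥ a_l, where l = max{0, i₁ − (H+1−α)}. (Lower-bound claim in the proof of Theorem 5: the best price is at least the reservation price computed by RLIS.) -/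
theorem aVal_zero (m M : ℝ) (n : ℕ) : aVal m M n 0 = m := by
  simp [aVal]

theorem aVal_mono {m M : ℝ} (hm : 0 < m) (hmM : m ≤ M) (n : ℕ) : Monotone (aVal m M n) := by
  intro i j hij
  have h1 : 1 ≤ M / m := (one_le_div hm).2 hmM
  unfold aVal
  gcongr

theorem stmt12 (m M : ℝ) (n H : ℕ) (pstar : ℝ)
    (hm : 0 < m) (hmM : m ≤ M) (hn : 1 ≤ n)
    (hps : pstar ∈ Set.Icc m M)
    (P : ℕ → Bool)
    (hwrong : ((Finset.Icc 1 n).filter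
        (fun i => P i ≠ correctResp m M n pstar i)).card ≤ H)
    (i₁ : ℕ) (hi₁ : i₁ ∈ Finset.Icc 1 n) (hP1 : P i₁ = true)
    (hleast : ∀ i ∈ Finset.Icc 1 n, P i = true → i₁ ≤ i)
    (α : ℕ) (hα : α = ((Finset.Ioc i₁ n).filter (fun j => P j = false)).card)
    (hαH : α ≤ H) :
    aVal m M n (i₁ - (H + 1 - α)) ≤ pstar := by
  obtain ⟨h1, hn₁⟩ := Finset.mem_Icc.1 hi₁
  set l := i₁ - (H + 1 - α) with hl
  rcases Nat.eq_zero_or_pos l with h0 | hpos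
  · rw [h0, aVal_zero]
    exact hps.1
  by_contra! hlt
  have hcorrect : ∀ i, l ≤ i → correctResp m M n pstar i = true := fun i hi =>
    decide_eq_true (hlt.trans_le (aVal_mono hm hmM n hi))
  have hdisj : Disjoint (Finset.Ico l i₁) ((Finset.Ioc i₁ n).filter (fun j => P j = false)) := by
    rw [Finset.disjoint_left]
    intro i hi hi'
    simp only [Finset.mem_filter, Finset.mem_Ico, Finset.mem_Ioc] at hi hi'
    omega
  have hsub : Finset.Ico l i₁ ∪ (Finset.Ioc i₁ n).filter (fun j => P j = false) ⊆
      (Finset.Icc 1 n).filter (fun i => P i ≠ correctResp m M n pstar i) := by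
    intro i hi
    rw [Finset.mem_union, Finset.mem_filter, Finset.mem_Ico, Finset.mem_Ioc] at hi
    have hmem : i ∈ Finset.Icc 1 n := Finset.mem_Icc.2 (by omega)
    have hPi : P i = false := by
      rcases hi with hi | hi
      · by_contra hne
        have := hleast i hmem (by simpa using hne)
        omega
      · exact hi.2
    rw [Finset.mem_filter, hPi, hcorrect i (by omega)]
    exact ⟨hmem, by decide⟩
  have hcard := Finset.card_le_card hsub
  rw [Finset.card_union_of_disjoint hdisj, Nat.card_Ico, ← hα] at hcard
  omega
end

section
/- Let P ∈ {0,1}^n be a response string in which at most H responses are wrong, suppose P contains at least one 1, let i₁ be the least index with P_{i₁} = 1, and let α be the number of indices j > i₁ with P_j = 0. Then p* ≤ a_{j'}, where j' = min{n, i₁ + α + H}; moreover if i₁ + α + H ≤ n then p* < a_{i₁+α+H}. (Upper-bound claim in the proof of Theorem 5.) -/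
theorem aVal_self {m : ℝ} (M : ℝ) {n : ℕ} (hm : 0 < m) (hn : 1 ≤ n) : aVal m M n n = M := by
  have h : (n : ℝ) ≠ 0 := by positivity
  rw [aVal, div_self h, Real.rpow_one, mul_div_cancel₀ _ hm.ne']

theorem stmt13 (m M : ℝ) (n H : ℕ) (pstar : ℝ)
    (hm : 0 < m) (hmM : m ≤ M) (hn : 1 ≤ n)
    (hps : pstar ∈ Set.Icc m M)
    (P : ℕ → Bool)
    (hwrong : ((Finset.Icc 1 n).filter
        (fun i => P i ≠ correctResp m M n pstar i)).card ≤ H)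
    (i₁ : ℕ) (hi₁ : i₁ ∈ Finset.Icc 1 n) (hP1 : P i₁ = true)
    (hleast : ∀ i ∈ Finset.Icc 1 n, P i = true → i₁ ≤ i)
    (α : ℕ) (hα : α = ((Finset.Ioc i₁ n).filter (fun j => P j = false)).card) :
    pstar ≤ aVal m M n (min n (i₁ + α + H)) ∧
    (i₁ + α + H ≤ n → pstar < aVal m M n (i₁ + α + H)) := by
  have key : i₁ + α + H ≤ n → pstar < aVal m M n (i₁ + α + H) := by
    intro hk
    by_contra! hge
    have hsub : Finset.Icc i₁ (i₁ + α + H) ⊆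
        (Finset.Icc 1 n).filter (fun i => P i ≠ correctResp m M n pstar i) ∪
          (Finset.Ioc i₁ n).filter (fun j => P j = false) := by
      intro j hj
      rw [Finset.mem_Icc] at hj hi₁
      have hc : correctResp m M n pstar j = false :=
        decide_eq_false (not_lt.2 ((aVal_mono hm hmM n hj.2).trans hge))
      rw [Finset.mem_union, Finset.mem_filter, Finset.mem_filter, hc, Finset.mem_Icc,
        Finset.mem_Ioc]
      by_cases hPj : P j = false
      · have hne : i₁ ≠ j := by
          rintro rfl
          simp [hP1] at hPj
        exact Or.inr ⟨by omega, hPj⟩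
      · exact Or.inl ⟨by omega, hPj⟩
    have hcard := (Finset.card_le_card hsub).trans (Finset.card_union_le _ _)
    rw [Nat.card_Icc] at hcard
    omega
  refine ⟨?_, key⟩
  rcases le_total (i₁ + α + H) n with hk | hk
  · rw [min_eq_right hk]
    exact (key hk).le
  · rw [min_eq_left hk, aVal_self M hm hn]
    exact hps.2
end
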